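/- arXiv:1803.08758 — 3 statements merged into one kernel-verified Lean document; each statement's English description precedes it below -/
import Mathlib

section
/- Let (Ω, 𝒜, λ) be a probability space, let ℬ and 𝒞 be sub-σ-algebras of 𝒜 that are conditionally independent relative to ℬ ∧_λ 𝒞, and let ℬ₁ be a sub-σ-algebra of ℬ. Then the σ-algebras (𝒞 ∨ ℬ₁) ∧_λ ℬ and (𝒞 ∧_λ ℬ) ∨ ℬ₁ agree up to λ-null sets: every set in either σ-algebra differs by a λ-null set from a set in the other. -/
open MeasureTheory Set

/-- The meet `ℬ₀ ∧_μ ℬ₁` of two sub-σ-algebras relative to a measure `μ`: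
the σ-algebra of all (ambient-)measurable sets `s` admitting `b₀ ∈ ℬ₀` and `b₁ ∈ ℬ₁`
with `μ (s ∆ b₀) = μ (s ∆ b₁) = 0`. -/
def meetAlg {α : Type*} {mα : MeasurableSpace α} (μ : Measure α)
    (B0 B1 : MeasurableSpace α) : MeasurableSpace α where
  MeasurableSet' s := MeasurableSet[mα] s ∧
    (∃ b0, MeasurableSet[B0] b0 ∧ μ (symmDiff s b0) = 0) ∧
    (∃ b1, MeasurableSet[B1] b1 ∧ μ (symmDiff s b1) = 0)
  measurableSet_empty :=
    ⟨@MeasurableSet.empty _ mα, ⟨∅, @MeasurableSet.empty _ B0, by simp⟩,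
      ⟨∅, @MeasurableSet.empty _ B1, by simp⟩⟩
  measurableSet_compl := by
    rintro s ⟨hs, ⟨b0, hb0, h0⟩, ⟨b1, hb1, h1⟩⟩
    exact ⟨hs.compl, ⟨b0ᶜ, hb0.compl, by rwa [compl_symmDiff_compl]⟩,
      ⟨b1ᶜ, hb1.compl, by rwa [compl_symmDiff_compl]⟩⟩
  measurableSet_iUnion := by
    intro f hf
    have key : ∀ (s b : ℕ → Set α),
        symmDiff (⋃ i, s i) (⋃ i, b i) ⊆ ⋃ i, symmDiff (s i) (b i) := by
      intro s b x hx
      rw [Set.mem_symmDiff] at hx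
      rcases hx with ⟨hx1, hx2⟩ | ⟨hx1, hx2⟩
      · obtain ⟨i, hi⟩ := Set.mem_iUnion.1 hx1
        exact Set.mem_iUnion.2 ⟨i, Set.mem_symmDiff.2
          (Or.inl ⟨hi, fun h => hx2 (Set.mem_iUnion.2 ⟨i, h⟩)⟩)⟩
      · obtain ⟨i, hi⟩ := Set.mem_iUnion.1 hx1
        exact Set.mem_iUnion.2 ⟨i, Set.mem_symmDiff.2
          (Or.inr ⟨hi, fun h => hx2 (Set.mem_iUnion.2 ⟨i, h⟩)⟩)⟩
    choose hmeas h0 h1 using hf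
    choose b0 hb0 hb0' using h0
    choose b1 hb1 hb1' using h1
    exact ⟨MeasurableSet.iUnion hmeas,
      ⟨⋃ i, b0 i, MeasurableSet.iUnion hb0,
        measure_mono_null (key f b0) (measure_iUnion_null hb0')⟩,
      ⟨⋃ i, b1 i, MeasurableSet.iUnion hb1,
        measure_mono_null (key f b1) (measure_iUnion_null hb1')⟩⟩

/-- Conditional independence of the sub-σ-algebras `B0` and `B1` relative to `B`,
with respect to the measure `μ`: `E(f₀ f₁ | B) = E(f₀ | B) ⬝ E(f₁ | B)` a.e. for all
bounded `B0`- resp. `B1`-measurable real functions. -/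
def CondIndepRel {α : Type*} {mα : MeasurableSpace α} (μ : Measure α)
    (B0 B1 B : MeasurableSpace α) : Prop :=
  ∀ f0 f1 : α → ℝ, Measurable[B0] f0 → Measurable[B1] f1 →
    (∃ C, ∀ x, |f0 x| ≤ C) → (∃ C, ∀ x, |f1 x| ≤ C) →
    μ[fun x => f0 x * f1 x|B] =ᵐ[μ] fun x => (μ[f0|B]) x * (μ[f1|B]) x

/-- Two σ-algebras agree up to `μ`-null sets: every set of either one differs from a set
of the other by a `μ`-null set. -/
def EqModNull {α : Type*} {mα : MeasurableSpace α} (μ : Measure α)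
    (B0 B1 : MeasurableSpace α) : Prop :=
  (∀ s, MeasurableSet[B0] s → ∃ t, MeasurableSet[B1] t ∧ μ (symmDiff s t) = 0) ∧
  (∀ s, MeasurableSet[B1] s → ∃ t, MeasurableSet[B0] t ∧ μ (symmDiff s t) = 0)


lemma aux_bdd {Ω : Type*} {mΩ : MeasurableSpace Ω} (μ : Measure Ω)
    (m : MeasurableSpace Ω) (s : Set Ω) :
    ∀ᵐ x ∂μ, ‖(@condExp Ω ℝ m mΩ _ _ μ (s.indicator fun _ => (1 : ℝ))) x‖ ≤ 1 := by
  have h := @ae_bdd_condExp_of_ae_bdd Ω m mΩ μ 1 (s.indicator fun _ => (1 : ℝ))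
    (Filter.Eventually.of_forall fun x => by
      by_cases hx : x ∈ s <;> simp [hx])
  simpa using h

lemma aux_indep {Ω : Type*} (B C M E : MeasurableSpace Ω) {mΩ : MeasurableSpace Ω}
    (μ : Measure Ω) [IsProbabilityMeasure μ] (hB : B ≤ mΩ) (hC : C ≤ mΩ)
    (hME : M ≤ E) (hE : E ≤ mΩ)
    (hEB : ∀ e, MeasurableSet[E] e → ∃ b, MeasurableSet[B] b ∧ e =ᵐ[μ] b)
    (hind : CondIndepRel μ B C M) (c : Set Ω) (hc : MeasurableSet[C] c) :
    μ[c.indicator (fun _ => (1 : ℝ))|M] =ᵐ[μ] μ[c.indicator (fun _ => (1 : ℝ))|E] := by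
  have hM := hME.trans hE
  have hci : Integrable (c.indicator (fun _ => (1 : ℝ))) μ :=
    (integrable_const 1).indicator (hC _ hc)
  refine ae_eq_condExp_of_forall_setIntegral_eq hE hci
    (fun s _ _ => integrable_condExp.integrableOn) ?_
    (stronglyMeasurable_condExp.mono hME).aestronglyMeasurable
  intro e he _
  obtain ⟨b, hb, heb⟩ := hEB e he
  rw [setIntegral_congr_set heb, setIntegral_congr_set heb]
  have hbi : Integrable (b.indicator (fun _ => (1 : ℝ))) μ :=
    (integrable_const 1).indicator (hB _ hb)
  have key := hind (b.indicator fun _ => 1) (c.indicator fun _ => 1)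
    (measurable_const.indicator hb) (measurable_const.indicator hc)
    ⟨1, fun x => by by_cases hx : x ∈ b <;> simp [hx]⟩
    ⟨1, fun x => by by_cases hx : x ∈ c <;> simp [hx]⟩
  have h2 : μ[μ[c.indicator (fun _ => (1 : ℝ))|M] * b.indicator (fun _ => (1 : ℝ))|M] =ᵐ[μ]
      μ[c.indicator (fun _ => (1 : ℝ))|M] * μ[b.indicator (fun _ => (1 : ℝ))|M] :=
    condExp_stronglyMeasurable_mul_of_bound hM stronglyMeasurable_condExp hbi 1
      (aux_bdd μ M c)
  have e1 : ∀ f : Ω → ℝ, ∫ x in b, f x ∂μ = ∫ x, f x * b.indicator (fun _ => (1 : ℝ)) x ∂μ := by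
    intro f
    rw [← integral_indicator (hB _ hb)]
    congr 1; ext x
    by_cases hx : x ∈ b <;> simp [hx]
  rw [e1, e1]
  calc _ = ∫ x, (μ[μ[c.indicator (fun _ => (1 : ℝ))|M] * b.indicator (fun _ => (1 : ℝ))|M]) x ∂μ :=
        (integral_condExp hM).symm
    _ = ∫ x, (μ[fun x => b.indicator (fun _ => (1 : ℝ)) x *
          c.indicator (fun _ => (1 : ℝ)) x|M]) x ∂μ := by
        apply integral_congr_ae
        filter_upwards [h2, key] with x h2 hk
        rw [h2, hk, Pi.mul_apply, mul_comm]
    _ = _ := by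
        rw [integral_condExp hM]
        simp_rw [mul_comm]

lemma aux_prod {Ω : Type*} (D E : MeasurableSpace Ω) {mΩ : MeasurableSpace Ω}
    (μ : Measure Ω) [IsProbabilityMeasure μ] (hDE : D ≤ E) (hE : E ≤ mΩ)
    (c s b : Set Ω) (hc : MeasurableSet c) (hs : MeasurableSet[E] s) (hb : MeasurableSet[D] b)
    (h : μ[c.indicator (fun _ => (1 : ℝ))|D] =ᵐ[μ] μ[c.indicator (fun _ => (1 : ℝ))|E]) :
    ∫ x in c ∩ b, s.indicator (fun _ => (1 : ℝ)) x ∂μ =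
      ∫ x in c ∩ b, (μ[s.indicator (fun _ => (1 : ℝ))|D]) x ∂μ := by
  have hD := hDE.trans hE
  have hci : Integrable (c.indicator (fun _ => (1 : ℝ))) μ := (integrable_const 1).indicator hc
  have hsi : Integrable (s.indicator (fun _ => (1 : ℝ))) μ :=
    (integrable_const 1).indicator (hE _ hs)
  set X := c.indicator (fun _ => (1 : ℝ)) with hX
  set Y := s.indicator (fun _ => (1 : ℝ)) with hY
  have hYX : Integrable (Y * X) μ := hci.bdd_mul (c := 1) hsi.1
    (Filter.Eventually.of_forall fun x => by by_cases hx : x ∈ s <;> simp [hY, hx])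
  have hDX : Integrable (μ[Y|D] * X) μ := hci.bdd_mul (c := 1) integrable_condExp.1
    (aux_bdd μ D s)
  have e1 : ∀ f : Ω → ℝ, ∫ x in c ∩ b, f x ∂μ = ∫ x in b, (f * X) x ∂μ := by
    intro f
    rw [inter_comm, ← setIntegral_indicator hc]
    congr 1; ext x
    by_cases hx : x ∈ c <;> simp [hX, hx]
  rw [e1, e1, ← setIntegral_condExp hD hYX hb, ← setIntegral_condExp hD hDX hb]
  apply setIntegral_congr_ae (hD _ hb)
  have a1 : μ[μ[Y|D] * X|D] =ᵐ[μ] μ[Y|D] * μ[X|D] :=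
    condExp_stronglyMeasurable_mul_of_bound hD stronglyMeasurable_condExp hci 1 (aux_bdd μ D s)
  have a2 : μ[Y * X|E] =ᵐ[μ] Y * μ[X|E] :=
    condExp_stronglyMeasurable_mul_of_bound hE (stronglyMeasurable_const.indicator hs) hci 1
      (Filter.Eventually.of_forall fun x => by by_cases hx : x ∈ s <;> simp [hY, hx])
  have a3 : μ[Y * X|E] =ᵐ[μ] μ[X|D] * Y := by
    filter_upwards [a2, h] with x h1 h2
    rw [h1, Pi.mul_apply, Pi.mul_apply, h2, mul_comm]
  have a4 : μ[μ[X|D] * Y|D] =ᵐ[μ] μ[X|D] * μ[Y|D] :=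
    condExp_stronglyMeasurable_mul_of_bound hD stronglyMeasurable_condExp hsi 1 (aux_bdd μ D c)
  have a5 : μ[μ[Y * X|E]|D] =ᵐ[μ] μ[Y * X|D] := condExp_condExp_of_le hDE hE
  filter_upwards [a1, a5, condExp_congr_ae (m := D) a3, a4] with x h1 h5 h3 h4 _
  rw [h1, ← h5, h3, h4, mul_comm]

lemma aux_pi {Ω : Type*} (C B1 : MeasurableSpace Ω) {mΩ : MeasurableSpace Ω}
    (μ : Measure Ω) (hC : C ≤ mΩ) (hB1 : B1 ≤ mΩ) (f g : Ω → ℝ)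
    (hf : Integrable f μ) (hg : Integrable g μ)
    (h : ∀ c b, MeasurableSet[C] c → MeasurableSet[B1] b →
      ∫ x in c ∩ b, f x ∂μ = ∫ x in c ∩ b, g x ∂μ) (d : Set Ω) (hd : MeasurableSet[C ⊔ B1] d) :
    ∫ x in d, f x ∂μ = ∫ x in d, g x ∂μ := by
  have hle : C ⊔ B1 ≤ mΩ := sup_le hC hB1
  have huniv : ∫ x, f x ∂μ = ∫ x, g x ∂μ := by
    simpa using h univ univ (@MeasurableSet.univ _ C) (@MeasurableSet.univ _ B1)
  refine @MeasurableSpace.induction_on_inter Ω (C ⊔ B1)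
    (fun d _ => ∫ x in d, f x ∂μ = ∫ x in d, g x ∂μ)
    {s | ∃ c b, MeasurableSet[C] c ∧ MeasurableSet[B1] b ∧ s = c ∩ b} ?_ ?_ ?_ ?_ ?_ ?_ d hd
  · apply le_antisymm
    · refine sup_le (fun s hs => ?_) (fun s hs => ?_)
      · exact MeasurableSpace.measurableSet_generateFrom
          ⟨s, univ, hs, @MeasurableSet.univ _ B1, by simp⟩
      · exact MeasurableSpace.measurableSet_generateFrom
          ⟨univ, s, @MeasurableSet.univ _ C, hs, by simp⟩
    · refine MeasurableSpace.generateFrom_le ?_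
      rintro s ⟨c, b, hc, hb, rfl⟩
      exact @MeasurableSet.inter _ (C ⊔ B1) _ _ ((le_sup_left : C ≤ C ⊔ B1) _ hc)
        ((le_sup_right : B1 ≤ C ⊔ B1) _ hb)
  · rintro _ ⟨c, b, hc, hb, rfl⟩ _ ⟨c2, b2, hc2, hb2, rfl⟩ _
    exact ⟨c ∩ c2, b ∩ b2, hc.inter hc2, hb.inter hb2, by rw [inter_inter_inter_comm]⟩
  · simp
  · rintro _ ⟨c, b, hc, hb, rfl⟩
    exact h c b hc hb
  · intro t ht hh
    have h1 := integral_add_compl (hle _ ht) hf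
    have h2 := integral_add_compl (hle _ ht) hg
    linarith
  · intro F hF hFm hh
    rw [integral_iUnion (fun i => hle _ (hFm i)) hF hf.integrableOn,
      integral_iUnion (fun i => hle _ (hFm i)) hF hg.integrableOn]
    simp_rw [hh]

lemma aux_main {Ω : Type*} (B C B1 M D E G : MeasurableSpace Ω) {mΩ : MeasurableSpace Ω}
    (μ : Measure Ω) [IsProbabilityMeasure μ] (hB : B ≤ mΩ) (hC : C ≤ mΩ) (hB1 : B1 ≤ B)
    (hMD : M ≤ D) (hDE : D ≤ E) (hE : E ≤ mΩ) (hB1D : B1 ≤ D)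
    (hEB : ∀ e, MeasurableSet[E] e → ∃ b, MeasurableSet[B] b ∧ e =ᵐ[μ] b)
    (hDG : D ≤ G) (hG : G ≤ mΩ)
    (hGC : ∀ e, MeasurableSet[G] e → ∃ b, MeasurableSet[C ⊔ B1] b ∧ e =ᵐ[μ] b)
    (hind : CondIndepRel μ B C M) (s : Set Ω) (hs : MeasurableSet[E] s)
    (hsG : MeasurableSet[G] s) :
    ∃ t, MeasurableSet[D] t ∧ μ (symmDiff s t) = 0 := by
  have hsi : Integrable (s.indicator (fun _ => (1 : ℝ))) μ :=
    (integrable_const 1).indicator (hE _ hs)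
  have hD := hDE.trans hE
  have hcond : ∀ c, MeasurableSet[C] c →
      μ[c.indicator (fun _ => (1 : ℝ))|D] =ᵐ[μ] μ[c.indicator (fun _ => (1 : ℝ))|E] := by
    intro c hc
    have h1 := aux_indep B C M E μ hB hC (hMD.trans hDE) hE hEB hind c hc
    have h2 := aux_indep B C M D μ hB hC hMD hD (fun e he => hEB e (hDE _ he)) hind c hc
    exact h2.symm.trans h1
  have hall := aux_pi C B1 μ hC (hB1.trans hB) _ _ hsi
    (integrable_condExp (m := D) (f := s.indicator (fun _ => (1 : ℝ))))
    (fun c b hc hb => aux_prod D E μ hDE hE c s b (hC _ hc) hs (hB1D _ hb) (hcond c hc))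
  have heq : s.indicator (fun _ => (1 : ℝ)) =ᵐ[μ] μ[s.indicator (fun _ => (1 : ℝ))|D] := by
    refine ae_eq_of_forall_setIntegral_eq_of_sigmaFinite' hG (fun _ _ _ => hsi.integrableOn)
      (fun _ _ _ => integrable_condExp.integrableOn) ?_
      (stronglyMeasurable_const.indicator hsG).aestronglyMeasurable
      (stronglyMeasurable_condExp.mono hDG).aestronglyMeasurable
    intro e he _
    obtain ⟨d, hd, hed⟩ := hGC e he
    rw [setIntegral_congr_set hed, setIntegral_congr_set hed]
    exact hall d hd
  have hm : Measurable[D] (μ[s.indicator (fun _ => (1 : ℝ))|D]) :=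
    stronglyMeasurable_condExp.measurable
  refine ⟨(μ[s.indicator (fun _ => (1 : ℝ))|D]) ⁻¹' {1}, hm (measurableSet_singleton 1), ?_⟩
  rw [measure_symmDiff_eq_zero_iff, Filter.eventuallyEq_set]
  filter_upwards [heq] with x hx
  rw [mem_preimage, mem_singleton_iff, ← hx]
  by_cases h : x ∈ s <;> simp [h]

lemma aux_le_meet {Ω : Type*} (H K L : MeasurableSpace Ω) {mΩ : MeasurableSpace Ω}
    (μ : Measure Ω) (hH : H ≤ mΩ)
    (h0 : ∀ s, MeasurableSet[H] s → ∃ b, MeasurableSet[K] b ∧ μ (symmDiff s b) = 0)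
    (h1 : ∀ s, MeasurableSet[H] s → ∃ b, MeasurableSet[L] b ∧ μ (symmDiff s b) = 0) :
    H ≤ meetAlg μ K L :=
  fun s hs => ⟨hH _ hs, h0 s hs, h1 s hs⟩

lemma aux_meet_le {Ω : Type*} (K L : MeasurableSpace Ω) {mΩ : MeasurableSpace Ω}
    (μ : Measure Ω) : meetAlg μ K L ≤ mΩ := fun _ hs => hs.1

lemma aux_self {Ω : Type*} (H K : MeasurableSpace Ω) {mΩ : MeasurableSpace Ω}
    (μ : Measure Ω) (h : H ≤ K) :
    ∀ s, MeasurableSet[H] s → ∃ b, MeasurableSet[K] b ∧ μ (symmDiff s b) = 0 :=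
  fun s hs => ⟨s, h _ hs, by simp⟩

lemma aux_final {Ω : Type*} (B C B1 : MeasurableSpace Ω) {mΩ : MeasurableSpace Ω}
    (μ : Measure Ω) [IsProbabilityMeasure μ]
    (hB : B ≤ mΩ) (hC : C ≤ mΩ) (hB1 : B1 ≤ B)
    (hind : CondIndepRel μ B C (meetAlg μ B C)) :
    EqModNull μ (meetAlg μ (C ⊔ B1) B) (meetAlg μ C B ⊔ B1) := by
  have hle : meetAlg μ C B ⊔ B1 ≤ meetAlg μ (C ⊔ B1) B := by
    refine sup_le (fun s hs => ?_)
      (aux_le_meet _ _ _ μ (hB1.trans hB) (aux_self _ _ μ le_sup_right) (aux_self _ _ μ hB1))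
    obtain ⟨h, ⟨c, hc, hc'⟩, h1⟩ := hs
    exact ⟨h, ⟨c, (le_sup_left : C ≤ C ⊔ B1) _ hc, hc'⟩, h1⟩
  refine ⟨fun s hs => ?_, fun s hs => ⟨s, hle _ hs, by simp⟩⟩
  have hE : meetAlg μ (C ⊔ B1) B ≤ mΩ := aux_meet_le _ _ μ
  refine aux_main B C B1 (meetAlg μ B C) _ (meetAlg μ (C ⊔ B1) B) (meetAlg μ (C ⊔ B1) B) μ
    hB hC hB1 ?_ hle hE le_sup_right ?_ hle hE ?_ hind s hs hs
  · refine le_trans (fun s hs => ?_) le_sup_left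
    exact ⟨hs.1, hs.2.2, hs.2.1⟩
  · rintro e ⟨_, _, b, hb, h⟩
    exact ⟨b, hb, measure_symmDiff_eq_zero_iff.1 h⟩
  · rintro e ⟨_, ⟨b, hb, h⟩, _⟩
    exact ⟨b, hb, measure_symmDiff_eq_zero_iff.1 h⟩

/-- **Modular law for meets and joins of σ-algebras** (Lemma 2.10 / Lemma A.7).
If `ℬ ⊥ 𝒞` (conditional independence relative to the meet `ℬ ∧_μ 𝒞`) and `ℬ₁ ⊆ ℬ`, then
`(𝒞 ∨ ℬ₁) ∧_μ ℬ` and `(𝒞 ∧_μ ℬ) ∨ ℬ₁` agree up to `μ`-null sets. -/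
theorem modular_law_meet_join
    {Ω : Type*} [mΩ : MeasurableSpace Ω] (μ : Measure Ω) [IsProbabilityMeasure μ]
    (B C B1 : MeasurableSpace Ω) (hB : B ≤ mΩ) (hC : C ≤ mΩ) (hB1 : B1 ≤ B)
    (hind : CondIndepRel μ B C (meetAlg μ B C)) :
    EqModNull μ (meetAlg μ (C ⊔ B1) B) (meetAlg μ C B ⊔ B1) := by
  exact aux_final B C B1 μ hB hC hB1 hind
end

section
/- Let (Ω, 𝒜, λ) be a probability space, S a finite set, μ a self-coupling of λ indexed by S, and T₁, T₂ ⊆ S. Then T₁ ⊥_μ T₂ holds if and only if for every bounded 𝒜^S_{T₁}-measurable function f : Ω^S → ℂ, the conditional expectation E_μ(f | 𝒜^S_{T₂}) is μ-almost everywhere equal to an 𝒜^S_{T₁∩T₂}-measurable function. -/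
open MeasureTheory Set

/-- The sub-σ-algebra `𝒜^S_T` of the product σ-algebra on `ι → Ω`:
preimages under the projection to coordinates in `T` of product-measurable sets. -/
def cylinderAlg {Ω : Type*} (ι : Type*) [MeasurableSpace Ω] (T : Set ι) :
    MeasurableSpace (ι → Ω) :=
  MeasurableSpace.comap (fun ω => T.restrict ω) MeasurableSpace.pi

/-- The relation `T₁ ⊥_μ T₂` for index sets of a self-coupling: the coordinate
σ-algebras `𝒜^S_{T₁}` and `𝒜^S_{T₂}` are conditionally independent relative to their
meet, and moreover this meet agrees with `𝒜^S_{T₁ ∩ T₂}` up to `μ`-null sets. -/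
def BotRel {Ω ι : Type*} [MeasurableSpace Ω] (μ : Measure (ι → Ω)) (T1 T2 : Set ι) : Prop :=
  CondIndepRel μ (cylinderAlg ι T1) (cylinderAlg ι T2)
      (meetAlg μ (cylinderAlg ι T1) (cylinderAlg ι T2)) ∧
  EqModNull μ (meetAlg μ (cylinderAlg ι T1) (cylinderAlg ι T2)) (cylinderAlg ι (T1 ∩ T2))


section Helpers

variable {α : Type*} {mα : MeasurableSpace α} {μ : Measure α}

theorem aux_meet_le_s5 (B0 B1 : MeasurableSpace α) : meetAlg μ B0 B1 ≤ mα := fun _ hs => hs.1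

theorem aux_le_meet_s5 {B0 B1 C : MeasurableSpace α} (h : B0 ≤ mα) (h0 : C ≤ B0) (h1 : C ≤ B1) :
    C ≤ meetAlg μ B0 B1 := fun s hs =>
  ⟨h _ (h0 _ hs), ⟨s, h0 _ hs, by simp⟩, ⟨s, h1 _ hs, by simp⟩⟩

theorem aux_int [IsFiniteMeasure μ] {f : α → ℝ} (hf : Measurable f) (hb : ∃ C, ∀ x, |f x| ≤ C) :
    Integrable f μ := by
  obtain ⟨C, hC⟩ := hb
  exact Integrable.of_bound hf.aestronglyMeasurable C (Filter.Eventually.of_forall hC)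

theorem aux_condExp_eq [IsFiniteMeasure μ] {M C : MeasurableSpace α} (hM : M ≤ mα) (hCM : C ≤ M)
    (h : ∀ s, MeasurableSet[M] s → ∃ t, MeasurableSet[C] t ∧ μ (symmDiff s t) = 0)
    {f : α → ℝ} (hf : Integrable f μ) : μ[f|C] =ᵐ[μ] μ[f|M] := by
  refine ae_eq_condExp_of_forall_setIntegral_eq hM hf
    (fun _ _ _ => integrable_condExp.integrableOn) ?_
    (stronglyMeasurable_condExp.mono hCM).aestronglyMeasurable
  intro s hs _
  obtain ⟨t, ht, hst⟩ := h s hs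
  have hst' : s =ᵐ[μ] t := measure_symmDiff_eq_zero_iff.1 hst
  rw [setIntegral_congr_set hst', setIntegral_congr_set hst',
    setIntegral_condExp (hCM.trans hM) hf ht]

theorem aux_forward [IsFiniteMeasure μ] {B0 B1 C : MeasurableSpace α} (h0 : B0 ≤ mα) (h1 : B1 ≤ mα)
    (hC1 : C ≤ B1)
    (h : CondIndepRel μ B0 B1 C) {f : α → ℝ} (hf : Measurable[B0] f) (hb : ∃ K, ∀ x, |f x| ≤ K) :
    μ[f|C] =ᵐ[μ] μ[f|B1] := by
  have hfi : Integrable f μ := aux_int (hf.mono h0 le_rfl) hb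
  refine ae_eq_condExp_of_forall_setIntegral_eq h1 hfi
    (fun _ _ _ => integrable_condExp.integrableOn) ?_
    (stronglyMeasurable_condExp.mono hC1).aestronglyMeasurable
  intro D hD _
  have hC := hC1.trans h1
  have hDm : MeasurableSet[mα] D := h1 _ hD
  set d : α → ℝ := D.indicator (fun _ => 1) with hd
  have hdm : Measurable[B1] d := by
    exact Measurable.indicator (m := B1) (measurable_const) hD
  have hdb : ∃ K, ∀ x, |d x| ≤ K := ⟨1, fun x => by
    by_cases hx : x ∈ D <;> simp [hd, hx]⟩
  have hdi : Integrable d μ := aux_int (hdm.mono h1 le_rfl) hdb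
  have hmul : ∀ g : α → ℝ, D.indicator g = fun x => g x * d x := by
    intro g; ext x; by_cases hx : x ∈ D <;> simp [hd, hx]
  have hI : ∀ g : α → ℝ, Integrable g μ → Integrable (fun x => g x * d x) μ := by
    intro g hg; rw [← hmul]; exact hg.indicator hDm
  rw [← integral_indicator hDm, ← integral_indicator hDm, hmul, hmul,
    ← integral_condExp hC (f := fun x => f x * d x),
    ← integral_condExp hC (f := fun x => (μ[f|C]) x * d x)]
  refine integral_congr_ae ?_
  have e1 := h f d hf hdm hb hdb
  have e2 : μ[(μ[f|C]) * d|C] =ᵐ[μ] (μ[f|C]) * μ[d|C] :=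
    condExp_mul_of_stronglyMeasurable_left stronglyMeasurable_condExp
      (hI _ integrable_condExp) hdi
  exact e2.trans e1.symm

theorem aux_main_s5 [IsFiniteMeasure μ] {B0 B1 C : MeasurableSpace α} (h0 : B0 ≤ mα) (h1 : B1 ≤ mα)
    (hC0 : C ≤ B0) (hC1 : C ≤ B1) :
    (CondIndepRel μ B0 B1 (meetAlg μ B0 B1) ∧ EqModNull μ (meetAlg μ B0 B1) C) ↔
      ∀ f : α → ℂ, Measurable[B0] f → (∃ C, ∀ x, ‖f x‖ ≤ C) →
        ∃ g : α → ℂ, Measurable[C] g ∧ μ[f|B1] =ᵐ[μ] g := by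
  have hM := aux_meet_le_s5 (μ := μ) B0 B1
  have hCM : C ≤ meetAlg μ B0 B1 := aux_le_meet_s5 h0 hC0 hC1
  have hC : C ≤ mα := hC1.trans h1
  constructor
  · rintro ⟨hci, heq, -⟩ f hf ⟨K, hK⟩
    have hci' : CondIndepRel μ B0 B1 C := by
      intro f0 f1 hf0 hf1 hb0 hb1
      have hi0 : Integrable f0 μ := aux_int (hf0.mono h0 le_rfl) hb0
      have hi1 : Integrable f1 μ := aux_int (hf1.mono h1 le_rfl) hb1
      have hi : Integrable (fun x => f0 x * f1 x) μ := by
        obtain ⟨K, hK⟩ := hb0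
        exact hi1.bdd_mul (hf0.mono h0 le_rfl).aestronglyMeasurable
          (Filter.Eventually.of_forall hK)
      filter_upwards [hci f0 f1 hf0 hf1 hb0 hb1, aux_condExp_eq hM hCM heq hi0,
        aux_condExp_eq hM hCM heq hi1, aux_condExp_eq hM hCM heq hi] with x a b c d
      rw [d, b, c, a]
    have hfi : Integrable f μ := Integrable.of_bound
      (hf.mono h0 le_rfl).aestronglyMeasurable K (Filter.Eventually.of_forall hK)
    refine ⟨μ[f|C], stronglyMeasurable_condExp.measurable, ?_⟩
    have hre := aux_forward h0 h1 hC1 hci' (f := fun x => (f x).re)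
      (Complex.measurable_re.comp hf) ⟨K, fun x => (Complex.abs_re_le_norm _).trans (hK x)⟩
    have him := aux_forward h0 h1 hC1 hci' (f := fun x => (f x).im)
      (Complex.measurable_im.comp hf) ⟨K, fun x => (Complex.abs_im_le_norm _).trans (hK x)⟩
    filter_upwards [hre, him, Complex.reCLM.comp_condExp_comm (m := C) hfi,
      Complex.reCLM.comp_condExp_comm (m := B1) hfi,
      Complex.imCLM.comp_condExp_comm (m := C) hfi,
      Complex.imCLM.comp_condExp_comm (m := B1) hfi] with x a b c d e g
    refine Complex.ext (d.trans (a.symm.trans c.symm)) (g.trans (b.symm.trans e.symm))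
  · intro H
    have HR : ∀ f : α → ℝ, Measurable[B0] f → (∃ C, ∀ x, |f x| ≤ C) →
        ∃ g : α → ℝ, Measurable[C] g ∧ μ[f|B1] =ᵐ[μ] g := by
      intro f hf hb
      have hfi : Integrable f μ := aux_int (hf.mono h0 le_rfl) hb
      obtain ⟨K, hK⟩ := hb
      obtain ⟨g, hg, hfg⟩ := H (fun x => (f x : ℂ)) (Complex.measurable_ofReal.comp hf)
        ⟨K, fun x => by simpa using hK x⟩
      refine ⟨fun x => (g x).re, Complex.measurable_re.comp hg, ?_⟩
      filter_upwards [hfg, Complex.reCLM.comp_condExp_comm (m := B1) hfi.ofReal] with x a b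
      rw [← a]
      exact b.symm
    have heq : ∀ s, MeasurableSet[meetAlg μ B0 B1] s →
        ∃ t, MeasurableSet[C] t ∧ μ (symmDiff s t) = 0 := by
      rintro s ⟨hs, ⟨b0, hb0, e0⟩, ⟨b1, hb1, e1⟩⟩
      rw [measure_symmDiff_eq_zero_iff] at e0 e1
      obtain ⟨g, hg, hfg⟩ := HR (b0.indicator fun _ => 1)
        (Measurable.indicator (m := B0) (measurable_const) hb0)
        ⟨1, fun x => by by_cases hx : x ∈ b0 <;> simp [hx]⟩
      refine ⟨g ⁻¹' {1}, hg (measurableSet_singleton _), ?_⟩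
      rw [measure_symmDiff_eq_zero_iff]
      refine e1.trans ?_
      have h01 : (b0.indicator fun _ => (1:ℝ)) =ᵐ[μ] b1.indicator fun _ => 1 :=
        @indicator_ae_eq_of_ae_eq_set _ _ mα _ _ _ _ _ (e0.symm.trans e1)
      have hb1i : μ[b1.indicator fun _ => (1:ℝ)|B1] = b1.indicator fun _ => 1 :=
        condExp_of_stronglyMeasurable h1
          ((Measurable.indicator (m := B1) (measurable_const) hb1).stronglyMeasurable)
          ((integrable_const _).indicator (h1 _ hb1))
      have hk := condExp_congr_ae (m := B1) h01
      rw [hb1i] at hk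
      filter_upwards [hk, hfg] with x a b
      rw [a] at b
      refine propext ?_
      change x ∈ b1 ↔ g x = 1
      rw [← b]
      by_cases hx : x ∈ b1 <;> simp [hx]
    refine ⟨?_, heq, fun s hs => ⟨s, hCM _ hs, by simp⟩⟩
    intro f0 f1 hf0 hf1 hb0 hb1
    have hi0 : Integrable f0 μ := aux_int (hf0.mono h0 le_rfl) hb0
    have hi1 : Integrable f1 μ := aux_int (hf1.mono h1 le_rfl) hb1
    have hi : Integrable (fun x => f0 x * f1 x) μ := by
      obtain ⟨K, hK⟩ := hb0
      exact hi1.bdd_mul (hf0.mono h0 le_rfl).aestronglyMeasurable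
        (Filter.Eventually.of_forall hK)
    have hE : μ[f0|B1] =ᵐ[μ] μ[f0|C] := by
      obtain ⟨g, hg, hfg⟩ := HR f0 hf0 hb0
      have a := condExp_condExp_of_le (f := f0) (μ := μ) hC1 h1
      have b := condExp_congr_ae (m := C) hfg
      rw [condExp_of_stronglyMeasurable hC hg.stronglyMeasurable
        (integrable_condExp.congr hfg)] at b
      exact hfg.trans (b.symm.trans a)
    have p1 : μ[f0 * f1|B1] =ᵐ[μ] μ[f0|B1] * f1 :=
      condExp_mul_of_stronglyMeasurable_right hf1.stronglyMeasurable hi hi0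
    have p2 : μ[f0|B1] * f1 =ᵐ[μ] μ[f0|C] * f1 := hE.mul (Filter.EventuallyEq.refl _ _)
    have p3 : μ[μ[f0|C] * f1|C] =ᵐ[μ] μ[f0|C] * μ[f1|C] := by
      refine condExp_mul_of_stronglyMeasurable_left stronglyMeasurable_condExp ?_ hi1
      obtain ⟨K, hK⟩ := hb1
      exact integrable_condExp.mul_bdd (c := K) (hf1.mono h1 le_rfl).aestronglyMeasurable
          (Filter.Eventually.of_forall hK)
    have p4 : μ[f0 * f1|C] =ᵐ[μ] μ[f0|C] * μ[f1|C] :=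
      (condExp_condExp_of_le hC1 h1).symm.trans
        ((condExp_congr_ae (p1.trans p2)).trans p3)
    filter_upwards [p4, aux_condExp_eq hM hCM heq hi0,
        aux_condExp_eq hM hCM heq hi1, aux_condExp_eq hM hCM heq hi] with x a b c d
    rw [← d, ← b, ← c]
    exact a

theorem aux_cyl_mono {Ω S : Type*} [MeasurableSpace Ω] {T T' : Set S} (h : T ⊆ T') :
    cylinderAlg (Ω := Ω) S T ≤ cylinderAlg S T' := by
  unfold cylinderAlg
  rw [← measurable_iff_comap_le]
  refine @measurable_pi_lambda _ _ _ (_) _ _ fun v => ?_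
  have : Measurable[MeasurableSpace.comap (fun ω : S → Ω => T'.restrict ω) MeasurableSpace.pi]
      (fun ω : S → Ω => T'.restrict ω) := comap_measurable _
  exact (measurable_pi_apply (⟨v, h v.2⟩ : T')).comp this

theorem aux_cyl_le {Ω S : Type*} [MeasurableSpace Ω] (T : Set S) :
    cylinderAlg (Ω := Ω) S T ≤ MeasurableSpace.pi := by
  unfold cylinderAlg
  rw [← measurable_iff_comap_le]
  exact measurable_pi_lambda _ fun v => measurable_pi_apply _

theorem aux_meas_subsingleton {β : Type*} [Subsingleton β] (B : MeasurableSpace β) (s : Set β) :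
    MeasurableSet[B] s := by
  rcases s.eq_empty_or_nonempty with rfl | ⟨x, hx⟩
  · exact MeasurableSet.empty
  · have : s = univ := Set.eq_univ_of_forall fun y => Subsingleton.elim x y ▸ hx
    rw [this]; exact MeasurableSet.univ

end Helpers

/-- **Characterization of the relation `⊥_μ` via conditional expectations** (Lemma 2.21).
For a self-coupling `μ` of `λ` indexed by a finite set `S` and index sets `T₁, T₂ ⊆ S`,
one has `T₁ ⊥_μ T₂` iff for every bounded `𝒜^S_{T₁}`-measurable `f : Ω^S → ℂ` the
conditional expectation `E_μ(f | 𝒜^S_{T₂})` is a.e. equal to an `𝒜^S_{T₁∩T₂}`-measurable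
function. -/
theorem botRel_iff_condexp_measurable
    {Ω : Type*} [mΩ : MeasurableSpace Ω] (lam : Measure Ω) [IsProbabilityMeasure lam]
    {S : Type*} [Fintype S]
    (μ : Measure (S → Ω)) (hcoup : ∀ v : S, μ.map (fun ω => ω v) = lam)
    (T1 T2 : Set S) :
    BotRel μ T1 T2 ↔
      ∀ f : (S → Ω) → ℂ, Measurable[cylinderAlg S T1] f → (∃ C, ∀ x, ‖f x‖ ≤ C) →
        ∃ g : (S → Ω) → ℂ, Measurable[cylinderAlg S (T1 ∩ T2)] g ∧
          μ[f|cylinderAlg S T2] =ᵐ[μ] g := by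
  rcases isEmpty_or_nonempty S with hS | ⟨⟨v⟩⟩
  · refine iff_of_true ⟨?_, ?_⟩ ?_
    · intro f0 f1 hf0 hf1 hb0 hb1
      have hB := aux_meet_le_s5 (μ := μ) (cylinderAlg S T1) (cylinderAlg S T2)
      by_cases hs : SigmaFinite (μ.trim hB)
      · have hfin : IsFiniteMeasure μ := by
          have hs' : SigmaFinite μ := SigmaFinite.of_trim hB
          refine ⟨?_⟩
          rcases isEmpty_or_nonempty (S → Ω) with he | ⟨⟨x⟩⟩
          · simp [Set.eq_empty_of_isEmpty]
          · have : (univ : Set (S → Ω)) ⊆ {x} := fun y _ => Subsingleton.elim y x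
            have hx : x ∈ ⋃ i, spanningSets μ i := by rw [iUnion_spanningSets]; trivial
            obtain ⟨i, hi⟩ := mem_iUnion.1 hx
            exact (measure_mono (this.trans (singleton_subset_iff.2 hi))).trans_lt
              (measure_spanningSets_lt_top μ i)
        have key : ∀ f : (S → Ω) → ℝ,
            μ[f|meetAlg μ (cylinderAlg S T1) (cylinderAlg S T2)] = f := by
          intro f
          refine condExp_of_stronglyMeasurable hB ?_ ?_
          · have : Measurable[meetAlg μ (cylinderAlg S T1) (cylinderAlg S T2)] f :=
              fun _ _ => aux_meas_subsingleton _ _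
            exact this.stronglyMeasurable
          · exact Integrable.of_finite
        rw [key, key, key]
      · rw [condExp_of_not_sigmaFinite hB hs, condExp_of_not_sigmaFinite hB hs]
        simp; rfl
    · exact ⟨fun s _ => ⟨s, aux_meas_subsingleton _ _, by simp⟩,
        fun s _ => ⟨s, aux_meas_subsingleton _ _, by simp⟩⟩
    · intro f _ _
      exact ⟨_, fun _ _ => aux_meas_subsingleton _ _, Filter.EventuallyEq.refl _ _⟩
  · have hfin : IsFiniteMeasure μ := by
      refine ⟨?_⟩
      have h1 : lam univ = μ univ := by
        rw [← hcoup v, Measure.map_apply (measurable_pi_apply v) MeasurableSet.univ, preimage_univ]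
      rw [← h1, measure_univ]
      exact ENNReal.one_lt_top
    exact aux_main_s5 (aux_cyl_le T1) (aux_cyl_le T2) (aux_cyl_mono inter_subset_left)
      (aux_cyl_mono inter_subset_right)
end

section
/- Let (Ω, 𝒜, λ) be a probability space and let μ be a self-coupling of λ indexed by the two-element set {a, b}. Suppose there exists a measure ν on the product measurable space (Ω^S, 𝒜^S) with S = {a, a′, b} such that: (1) the pushforward of ν under ω ↦ (ω(a), ω(b)) equals μ; (2) the pushforward of ν under ω ↦ (ω(a′), ω(b)) equals μ; (3) {a, b} ⊥_ν {a′, b}; and (4) the pushforward of ν under ω ↦ (ω(a), ω(a′)) equals μ. Then there exists a sub-σ-algebra ℬ ⊆ 𝒜 such that μ is the square of λ relative to ℬ, i.e. μ(A₀ × A₁) = ∫_Ω E(1_{A₀} | ℬ) · E(1_{A₁} | ℬ) dλ for all A₀, A₁ ∈ 𝒜. -/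
open MeasureTheory Set

/-- `μ` is the square of `lam` relative to the sub-σ-algebra `B`:
`μ(A₀ × A₁) = ∫ E(1_{A₀}|B) ⬝ E(1_{A₁}|B) dlam` for all measurable `A₀, A₁`. -/
def IsRelativeSquare {Ω : Type*} {mΩ : MeasurableSpace Ω} (lam : Measure Ω)
    (B : MeasurableSpace Ω) (μ : @Measure (Ω × Ω) (mΩ.prod mΩ)) : Prop :=
  ∀ A0 A1 : Set Ω, MeasurableSet[mΩ] A0 → MeasurableSet[mΩ] A1 →
    μ (A0 ×ˢ A1) = ENNReal.ofReal (∫ x,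
      (lam[A0.indicator (fun _ => (1 : ℝ))|B]) x *
        (lam[A1.indicator (fun _ => (1 : ℝ))|B]) x ∂lam)


lemma integrable_of_bdd_one {α : Type*} {mα : MeasurableSpace α} (μ : Measure α)
    [IsFiniteMeasure μ] {f : α → ℝ} (hf : Measurable f) (hb : ∀ x, |f x| ≤ 1) :
    Integrable f μ :=
  Integrable.of_bound hf.aestronglyMeasurable 1 (Filter.Eventually.of_forall hb)

lemma mul_bdd_one {a b : ℝ} (ha : |a| ≤ 1) (hb : |b| ≤ 1) : |a * b| ≤ 1 := by
  rw [abs_mul]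
  exact mul_le_one₀ ha (abs_nonneg _) hb

/-- The Markov operator of a coupling on bounded functions. -/
lemma exists_markov {Ω : Type*} [mΩ : MeasurableSpace Ω]
    (μ : Measure (Ω × Ω)) [IsFiniteMeasure μ] (f : Ω → ℝ) (hf : Measurable f)
    (hb : ∀ x, |f x| ≤ 1) :
    ∃ g : Ω → ℝ, Measurable g ∧ (∀ x, |g x| ≤ 1) ∧
      ∀ h : Ω → ℝ, Measurable h → (∀ x, |h x| ≤ 1) →
        ∫ p, f p.1 * h p.2 ∂μ = ∫ p, g p.2 * h p.2 ∂μ := by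
  have hm : MeasurableSpace.comap (Prod.snd : Ω × Ω → Ω) mΩ ≤ Prod.instMeasurableSpace :=
    measurable_snd.comap_le
  have hF : Integrable (fun p : Ω × Ω => f p.1) μ :=
    integrable_of_bdd_one μ (hf.comp measurable_fst) (fun p => hb p.1)
  obtain ⟨g, hg, hgeq⟩ :=
    (stronglyMeasurable_condExp (μ := μ) (f := fun p : Ω × Ω => f p.1)
      (m := MeasurableSpace.comap (Prod.snd : Ω × Ω → Ω) mΩ)).measurable.exists_eq_measurable_comp
  have hbd : ∀ᵐ p ∂μ, |(μ[fun p : Ω × Ω => f p.1|MeasurableSpace.comap (Prod.snd : Ω × Ω → Ω) mΩ]) p| ≤ ((1 : NNReal) : ℝ) :=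
    ae_bdd_condExp_of_ae_bdd (Filter.Eventually.of_forall fun p => by simpa using hb p.1)
  refine ⟨fun x => max (-1) (min (g x) 1), by fun_prop, fun x => ?_, fun h hh hhb => ?_⟩
  · rw [abs_le]
    exact ⟨le_max_left _ _, max_le (by norm_num) (min_le_right _ _)⟩
  have hH : StronglyMeasurable[MeasurableSpace.comap (Prod.snd : Ω × Ω → Ω) mΩ]
      (fun p : Ω × Ω => h p.2) :=
    (hh.comp (comap_measurable (Prod.snd : Ω × Ω → Ω))).stronglyMeasurable
  have hFH : Integrable (fun p : Ω × Ω => f p.1 * h p.2) μ :=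
    integrable_of_bdd_one μ (by fun_prop) (fun p => mul_bdd_one (hb _) (hhb _))
  rw [← integral_condExp hm]
  refine integral_congr_ae ?_
  have := condExp_mul_of_stronglyMeasurable_right hH hFH hF
  filter_upwards [this, hbd] with p hp hp2
  refine hp.trans ?_
  simp only [Pi.mul_apply]
  rw [hgeq] at hp2 ⊢
  simp only [Function.comp_apply, NNReal.coe_one, abs_le] at hp2 ⊢
  rw [min_eq_left hp2.2, max_eq_right hp2.1]

lemma setIntegral_of_symmDiff {α : Type*} {mα : MeasurableSpace α} {μ : Measure α} {s t : Set α}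
    (h : μ (symmDiff s t) = 0) (f : α → ℝ) : ∫ x in s, f x ∂μ = ∫ x in t, f x ∂μ :=
  setIntegral_congr_set (measure_symmDiff_eq_zero_iff.1 h)

lemma cyl_measurable {Ω ι : Type*} [MeasurableSpace Ω] {T : Set ι} {i : ι} (hi : i ∈ T) :
    Measurable[cylinderAlg ι T] (fun ω : ι → Ω => ω i) := by
  have h1 : Measurable[cylinderAlg ι T] (fun ω : ι → Ω => T.restrict ω) := comap_measurable _
  exact (measurable_pi_apply (⟨i, hi⟩ : T)).comp h1

lemma cyl_le {Ω ι : Type*} [MeasurableSpace Ω] (T : Set ι) :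
    cylinderAlg (Ω := Ω) ι T ≤ MeasurableSpace.pi := by
  refine Measurable.comap_le ?_
  exact measurable_pi_lambda _ fun i => measurable_pi_apply _

lemma meetAlg_le {α : Type*} {mα : MeasurableSpace α} (μ : Measure α)
    (B0 B1 : MeasurableSpace α) : meetAlg μ B0 B1 ≤ mα := fun _ h => h.1

lemma cyl_singleton {Ω : Type*} [mΩ : MeasurableSpace Ω] {t : Set (Fin 3 → Ω)}
    (ht : MeasurableSet[cylinderAlg (Fin 3) (({0, 2} : Set (Fin 3)) ∩ {1, 2})] t) :
    ∃ u : Set Ω, MeasurableSet u ∧ (fun ω : Fin 3 → Ω => ω 2) ⁻¹' u = t := by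
  have hle : cylinderAlg (Ω := Ω) (Fin 3) (({0, 2} : Set (Fin 3)) ∩ {1, 2}) ≤
      MeasurableSpace.comap (fun ω : Fin 3 → Ω => ω 2) mΩ := by
    unfold cylinderAlg
    rw [← measurable_iff_comap_le]
    refine @measurable_pi_lambda _ _ _ (MeasurableSpace.comap (fun ω : Fin 3 → Ω => ω 2) mΩ) _ _ ?_
    rintro ⟨i, hi⟩
    have : i = 2 := by
      simp only [mem_inter_iff, mem_insert_iff, mem_singleton_iff] at hi
      omega
    subst this
    exact comap_measurable _
  exact hle _ ht

/-- Identification of the conditional expectation relative to the meet. -/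
lemma condExp_meet {Ω : Type*} [mΩ : MeasurableSpace Ω] (μ : Measure (Ω × Ω))
    (ν : Measure (Fin 3 → Ω)) [IsFiniteMeasure ν] (i : Fin 3)
    (hi : ν.map (fun ω => (ω i, ω 2)) = μ)
    (hbot : BotRel ν ({0, 2} : Set (Fin 3)) ({1, 2} : Set (Fin 3)))
    (f g : Ω → ℝ) (hf : Measurable f) (hfb : ∀ x, |f x| ≤ 1)
    (hg : Measurable g) (hgb : ∀ x, |g x| ≤ 1)
    (hfg : ∀ h : Ω → ℝ, Measurable h → (∀ x, |h x| ≤ 1) →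
        ∫ p, f p.1 * h p.2 ∂μ = ∫ p, g p.2 * h p.2 ∂μ) :
    (fun ω => g (ω 2)) =ᵐ[ν] ν[fun ω => f (ω i)|meetAlg ν (cylinderAlg (Fin 3) {0, 2})
      (cylinderAlg (Fin 3) {1, 2})] := by
  have hI : ∀ (j : Fin 3) {k : Ω → ℝ}, Measurable k → (∀ x, |k x| ≤ 1) →
      Integrable (fun ω : Fin 3 → Ω => k (ω j)) ν := fun j k hk hkb =>
    integrable_of_bdd_one ν (hk.comp (measurable_pi_apply j)) (fun _ => hkb _)
  refine ae_eq_condExp_of_forall_setIntegral_eq (meetAlg_le _ _ _) (hI i hf hfb)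
    (fun s _ _ => (hI 2 hg hgb).integrableOn) ?_ ?_
  · intro s hs _
    obtain ⟨t, ht, hst⟩ := hbot.2.1 s hs
    obtain ⟨u, hu, rfl⟩ := cyl_singleton ht
    rw [setIntegral_of_symmDiff hst, setIntegral_of_symmDiff hst]
    have h2 : Measurable (fun ω : Fin 3 → Ω => ω 2) := measurable_pi_apply 2
    rw [← integral_indicator (h2 hu), ← integral_indicator (h2 hu)]
    have hone : Measurable (u.indicator (fun _ => (1 : ℝ))) := measurable_const.indicator hu
    have key := hfg (u.indicator fun _ => 1) hone (fun x => by
      by_cases hx : x ∈ u <;> simp [hx])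
    have hmeas : Measurable (fun ω : Fin 3 → Ω => (ω i, ω 2)) :=
      (measurable_pi_apply i).prodMk h2
    rw [← hi, integral_map hmeas.aemeasurable
      (Measurable.aestronglyMeasurable (by fun_prop)),
      integral_map hmeas.aemeasurable (Measurable.aestronglyMeasurable (by fun_prop))] at key
    convert key.symm using 2
    · funext ω
      by_cases hx : ω 2 ∈ u <;> simp [hx]
    · funext ω
      by_cases hx : ω 2 ∈ u <;> simp [hx]
  · refine StronglyMeasurable.aestronglyMeasurable ?_
    refine Measurable.stronglyMeasurable ?_
    intro U hU
    have hU' := hg hU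
    refine ⟨(hg.comp (measurable_pi_apply 2)) hU, ⟨_, ?_, by rw [symmDiff_self]; simp⟩,
      ⟨_, ?_, by rw [symmDiff_self]; simp⟩⟩
    · exact (cyl_measurable (i := (2 : Fin 3)) (by simp)) hU'
    · exact (cyl_measurable (i := (2 : Fin 3)) (by simp)) hU'

/-- The σ-algebra of sets invariant under the coupling. -/
def invAlg {Ω : Type*} [mΩ : MeasurableSpace Ω] (μ : Measure (Ω × Ω)) : MeasurableSpace Ω where
  MeasurableSet' s := MeasurableSet[mΩ] s ∧ ∀ᵐ p ∂μ, (p.1 ∈ s ↔ p.2 ∈ s)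
  measurableSet_empty := ⟨MeasurableSet.empty, by simp⟩
  measurableSet_compl := by
    rintro s ⟨hs, h⟩
    refine ⟨hs.compl, ?_⟩
    filter_upwards [h] with p hp
    simp [hp]
  measurableSet_iUnion := by
    intro s hs
    refine ⟨MeasurableSet.iUnion fun i => (hs i).1, ?_⟩
    filter_upwards [ae_all_iff.2 fun i => (hs i).2] with p hp
    simp [hp]

theorem idempotent_coupling_is_relative_square
    {Ω : Type*} [mΩ : MeasurableSpace Ω] (lam : Measure Ω) [IsProbabilityMeasure lam]
    (μ : Measure (Ω × Ω))
    (hcoupa : μ.map Prod.fst = lam) (hcoupb : μ.map Prod.snd = lam)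
    (ν : Measure (Fin 3 → Ω))
    (hab : ν.map (fun ω => (ω 0, ω 2)) = μ)
    (ha'b : ν.map (fun ω => (ω 1, ω 2)) = μ)
    (hbot : BotRel ν ({0, 2} : Set (Fin 3)) ({1, 2} : Set (Fin 3)))
    (haa' : ν.map (fun ω => (ω 0, ω 1)) = μ) :
    ∃ B : MeasurableSpace Ω, B ≤ mΩ ∧ IsRelativeSquare lam B μ := by
  have hm02 : Measurable (fun ω : Fin 3 → Ω => (ω 0, ω 2)) := by fun_prop
  have hm01 : Measurable (fun ω : Fin 3 → Ω => (ω 0, ω 1)) := by fun_prop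
  have hμ : IsProbabilityMeasure μ := ⟨by
    have : lam univ = 1 := measure_univ
    rwa [← hcoupa, Measure.map_apply measurable_fst MeasurableSet.univ, preimage_univ] at this⟩
  have hν : IsProbabilityMeasure ν := ⟨by
    have : μ univ = 1 := measure_univ
    rwa [← hab, Measure.map_apply hm02 MeasurableSet.univ, preimage_univ] at this⟩
  have hint1 : ∀ k : Ω → ℝ, Measurable k → ∫ p, k p.1 ∂μ = ∫ x, k x ∂lam := by
    intro k hk
    rw [← hcoupa, integral_map measurable_fst.aemeasurable hk.aestronglyMeasurable]
  have hint2 : ∀ k : Ω → ℝ, Measurable k → ∫ p, k p.2 ∂μ = ∫ x, k x ∂lam := by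
    intro k hk
    rw [← hcoupb, integral_map measurable_snd.aemeasurable hk.aestronglyMeasurable]
  choose! P hPm hPb hP using fun (f : Ω → ℝ) (h : Measurable f ∧ ∀ x, |f x| ≤ 1) =>
    exists_markov μ f h.1 h.2
  -- conditional independence
  have hCI : ∀ f h : Ω → ℝ, (Measurable f ∧ ∀ x, |f x| ≤ 1) → (Measurable h ∧ ∀ x, |h x| ≤ 1) →
      ∫ p, f p.1 * h p.2 ∂μ = ∫ x, P f x * P h x ∂lam := by
    intro f h hf hh
    have e0 := condExp_meet μ ν 0 hab hbot f (P f) hf.1 hf.2 (hPm f hf) (hPb f hf) (hP f hf)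
    have e1 := condExp_meet μ ν 1 ha'b hbot h (P h) hh.1 hh.2 (hPm h hh) (hPb h hh) (hP h hh)
    have e := hbot.1 (fun ω => f (ω 0)) (fun ω => h (ω 1))
      (hf.1.comp (cyl_measurable (by simp))) (hh.1.comp (cyl_measurable (by simp)))
      ⟨1, fun _ => hf.2 _⟩ ⟨1, fun _ => hh.2 _⟩
    have hfm := hf.1
    have hhm := hh.1
    have hPf := hPm f hf
    have hPh := hPm h hh
    rw [← hint2 (fun x => P f x * P h x) (by fun_prop)]
    conv_rhs => rw [← hab]
    rw [integral_map hm02.aemeasurable (Measurable.aestronglyMeasurable (by fun_prop))]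
    conv_lhs => rw [← haa']
    rw [integral_map hm01.aemeasurable (Measurable.aestronglyMeasurable (by fun_prop))]
    rw [← integral_condExp (meetAlg_le ν (cylinderAlg (Fin 3) {0, 2}) (cylinderAlg (Fin 3) {1, 2}))]
    refine integral_congr_ae ?_
    filter_upwards [e0, e1, e] with ω h0 h1 h2
    rw [h2, ← h0, ← h1]
  -- invariance of the range
  have hinv : ∀ f : Ω → ℝ, (Measurable f ∧ ∀ x, |f x| ≤ 1) → ∀ᵐ p ∂μ, P f p.1 = P f p.2 := by
    intro f hf
    have hg : Measurable (P f) ∧ ∀ x, |P f x| ≤ 1 := ⟨hPm f hf, hPb f hf⟩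
    have hgm := hg.1
    have hPg := hPm _ hg
    have h1 : ∫ p, P f p.1 * P f p.2 ∂μ = ∫ x, P f x * P f x ∂lam := by
      rw [hP _ hg _ hg.1 hg.2, hint2 (fun x => P (P f) x * P f x) (by fun_prop)]
      rw [← hint2 (fun x => P f x * P f x) (by fun_prop), ← hP f hf _ hg.1 hg.2, hCI f _ hf hg]
      exact integral_congr_ae (Filter.Eventually.of_forall fun x => mul_comm _ _)
    have I1 : Integrable (fun p : Ω × Ω => P f p.1 * P f p.1) μ :=
      integrable_of_bdd_one μ (by fun_prop) fun p => mul_bdd_one (hg.2 _) (hg.2 _)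
    have I2 : Integrable (fun p : Ω × Ω => P f p.2 * P f p.2) μ :=
      integrable_of_bdd_one μ (by fun_prop) fun p => mul_bdd_one (hg.2 _) (hg.2 _)
    have I3 : Integrable (fun p : Ω × Ω => P f p.1 * P f p.2) μ :=
      integrable_of_bdd_one μ (by fun_prop) fun p => mul_bdd_one (hg.2 _) (hg.2 _)
    have hz : ∫ p, (P f p.1 - P f p.2) ^ 2 ∂μ = 0 := by
      have : (fun p : Ω × Ω => (P f p.1 - P f p.2) ^ 2) = fun p =>
          (P f p.1 * P f p.1 + P f p.2 * P f p.2) - 2 * (P f p.1 * P f p.2) := by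
        funext p; ring
      have I12 : Integrable (fun p : Ω × Ω => P f p.1 * P f p.1 + P f p.2 * P f p.2) μ :=
        I1.add I2
      rw [this, integral_sub I12 (I3.const_mul 2), integral_add I1 I2,
        integral_const_mul, h1, hint1 (fun x => P f x * P f x) (by fun_prop),
        hint2 (fun x => P f x * P f x) (by fun_prop)]
      ring
    have Isq : Integrable (fun p : Ω × Ω => (P f p.1 - P f p.2) ^ 2) μ := by
      have : (fun p : Ω × Ω => (P f p.1 - P f p.2) ^ 2) = fun p =>
          (P f p.1 * P f p.1 + P f p.2 * P f p.2) - 2 * (P f p.1 * P f p.2) := by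
        funext p; ring
      rw [this]
      exact (I1.add I2).sub (I3.const_mul 2)
    have := (integral_eq_zero_iff_of_nonneg (fun p => sq_nonneg _) Isq).1 hz
    filter_upwards [this] with p hp
    exact sub_eq_zero.1 (pow_eq_zero_iff (two_ne_zero)|>.1 hp)
  have hBle : invAlg μ ≤ mΩ := fun _ h => h.1
  have hind : ∀ A : Set Ω, MeasurableSet A →
      (Measurable (A.indicator (fun _ => (1 : ℝ))) ∧
        ∀ x, |A.indicator (fun _ => (1 : ℝ)) x| ≤ 1) := fun A hA =>
    ⟨measurable_const.indicator hA, fun x => by by_cases hx : x ∈ A <;> simp [hx]⟩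
  -- the operator is the conditional expectation
  have hcond : ∀ f : Ω → ℝ, (Measurable f ∧ ∀ x, |f x| ≤ 1) → P f =ᵐ[lam] lam[f|invAlg μ] := by
    intro f hf
    have hfm := hf.1
    have hgm := hPm f hf
    refine ae_eq_condExp_of_forall_setIntegral_eq hBle (integrable_of_bdd_one lam hf.1 hf.2)
      (fun s _ _ => (integrable_of_bdd_one lam (hPm f hf) (hPb f hf)).integrableOn) ?_ ?_
    · intro s hs _
      have hsm : MeasurableSet s := hs.1
      have hi := (hind s hsm).1
      have e : ∀ k : Ω → ℝ, ∫ x in s, k x ∂lam =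
          ∫ x, k x * s.indicator (fun _ => (1 : ℝ)) x ∂lam := by
        intro k
        rw [← integral_indicator hsm]
        congr 1
        funext x
        by_cases hx : x ∈ s <;> simp [hx]
      rw [e, e, ← hint2 (fun x => P f x * s.indicator (fun _ => (1 : ℝ)) x) (by fun_prop),
        ← hint1 (fun x => f x * s.indicator (fun _ => (1 : ℝ)) x) (by fun_prop),
        ← hP f hf _ hi (hind s hsm).2]
      refine integral_congr_ae ?_
      filter_upwards [hs.2] with p hp
      by_cases hx : p.1 ∈ s
      · simp [hx, hp.1 hx]
      · simp [hx, mt hp.2 hx]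
    · refine StronglyMeasurable.aestronglyMeasurable (Measurable.stronglyMeasurable ?_)
      intro U hU
      refine ⟨hgm hU, ?_⟩
      filter_upwards [hinv f hf] with p hp
      simp [hp]
  refine ⟨invAlg μ, hBle, fun A0 A1 h0 h1 => ?_⟩
  have e : ∫ x, (lam[A0.indicator (fun _ => (1 : ℝ))|invAlg μ]) x *
        (lam[A1.indicator (fun _ => (1 : ℝ))|invAlg μ]) x ∂lam = μ.real (A0 ×ˢ A1) := by
    rw [← integral_indicator_one (h0.prod h1)]
    trans ∫ x, P (A0.indicator fun _ => 1) x * P (A1.indicator fun _ => 1) x ∂lam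
    · refine integral_congr_ae ?_
      filter_upwards [hcond _ (hind A0 h0), hcond _ (hind A1 h1)] with x hx hy
      rw [hx, hy]
    · rw [← hCI _ _ (hind A0 h0) (hind A1 h1)]
      congr 1
      funext p
      by_cases hx : p.1 ∈ A0 <;> by_cases hy : p.2 ∈ A1 <;> simp [hx, hy, Set.indicator]
  rw [e, measureReal_def, ENNReal.ofReal_toReal (measure_ne_top _ _)]
end
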